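/- arXiv:1303.3717 — 3 statements merged into one kernel-verified Lean document; each statement's English description precedes it below -/
import Mathlib

section
/- For every vector u ∈ ℝ^M, the matrix Q contracts both the discrete L² norm and the discrete h¹ seminorm: ‖Q u‖_{ℓ²} ≤ ‖u‖_{ℓ²} and |Q u|_{h¹} ≤ |u|_{h¹}. -/
open MeasureTheory ProbabilityTheory Real Finset

noncomputable section

/-- The 1-periodic hat function associated with the node `x_k = k/M`:
the unique continuous 1-periodic function, affine on each interval between
consecutive nodes, equal to 1 at `x_k` and 0 at the other nodes. -/
def hatFn (M : ℕ) (k : ZMod M) (x : ℝ) : ℝ :=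
  max 0 (1 - (M : ℝ) * |(x - (k.val : ℝ) / M) - ((round (x - (k.val : ℝ) / M) : ℤ) : ℝ)|)

/-- The piecewise linear 1-periodic interpolant of nodal values `u`. -/
def interp (M : ℕ) [NeZero M] (u : ZMod M → ℝ) (x : ℝ) : ℝ :=
  ∑ k : ZMod M, u k * hatFn M k x

/-- Discrete `ℓ²` squared norm: `δx ∑ⱼ uⱼ²` with `δx = 1/M`. -/
def l2sq (M : ℕ) [NeZero M] (u : ZMod M → ℝ) : ℝ :=
  (1 / M : ℝ) * ∑ j : ZMod M, (u j) ^ 2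

/-- Discrete `h¹` squared seminorm: `δx ∑ⱼ ((u_{j+1} - u_j)/δx)²` with `δx = 1/M`. -/
def h1sq (M : ℕ) [NeZero M] (u : ZMod M → ℝ) : ℝ :=
  (1 / M : ℝ) * ∑ j : ZMod M, ((u (j + 1) - u j) / (1 / M : ℝ)) ^ 2

/-- The matrix `Q` with entries `Q j k = ∫ φ_k(x_j + y) dγ_{δt}(y)`, `γ_{δt}` being the
centered Gaussian measure with variance `δt`. -/
def Qmat (M : ℕ) [NeZero M] (δt : ℝ) : Matrix (ZMod M) (ZMod M) ℝ :=
  fun j k => ∫ y, hatFn M k ((j.val : ℝ) / M + y) ∂(gaussianReal 0 δt.toNNReal)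

/-- The random matrix `P` with entries `P j k = φ_k(x_j + √δt G^j)`. -/
def Pmat (M : ℕ) [NeZero M] (δt : ℝ) {Ω : Type} (G : ZMod M → Ω → ℝ) (ω : Ω) :
    Matrix (ZMod M) (ZMod M) ℝ :=
  fun j k => hatFn M k ((j.val : ℝ) / M + Real.sqrt δt * G j ω)

/-- The averaged random matrix `P̄` with entries
`P̄ j k = (1/N) ∑ₘ φ_k(x_j + √δt G^{m,j})`. -/
def Pbar (M : ℕ) [NeZero M] (δt : ℝ) (N : ℕ) {Ω : Type} (G : Fin N × ZMod M → Ω → ℝ)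
    (ω : Ω) : Matrix (ZMod M) (ZMod M) ℝ :=
  fun j k => (1 / N : ℝ) * ∑ m : Fin N, hatFn M k ((j.val : ℝ) / M + Real.sqrt δt * G (m, j) ω)

/-- The sequence of averaged random matrices `P⁽ⁱ⁾` with entries
`P⁽ⁱ⁾ j k = (1/N) ∑ₘ φ_k(x_j + √δt G^{i,m,j})`. -/
def PbarSeq (M : ℕ) [NeZero M] (δt : ℝ) (N : ℕ) {Ω : Type}
    (G : ℕ × Fin N × ZMod M → Ω → ℝ) (i : ℕ) (ω : Ω) : Matrix (ZMod M) (ZMod M) ℝ :=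
  fun j k => (1 / N : ℝ) * ∑ m : Fin N, hatFn M k ((j.val : ℝ) / M + Real.sqrt δt * G (i, m, j) ω)

/-- Descending product `P^{(n-1)} ⋯ P^{(0)}` (with the convention that the empty
product is the identity matrix). -/
def prodDesc {I : Type} [Fintype I] [DecidableEq I] (P : ℕ → Matrix I I ℝ) : ℕ → Matrix I I ℝ
  | 0 => 1
  | n + 1 => P n * prodDesc P n

/-- Descending product starting from index `a`: `prodDescFrom P a s = P^{(a+s-1)} ⋯ P^{(a)}`
(identity for `s = 0`). -/
def prodDescFrom {I : Type} [Fintype I] [DecidableEq I] (P : ℕ → Matrix I I ℝ) (a : ℕ) :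
    ℕ → Matrix I I ℝ
  | 0 => 1
  | s + 1 => P (a + s) * prodDescFrom P a s

end

/-- The two-point weight describing the values of the hat function. -/
noncomputable def hatW (M : ℕ) (d : ZMod M) (f : ℝ) : ℝ :=
  (if d = 0 then 1 - f else 0) + (if d = -1 then f else 0)

lemma hatFn_eq (M : ℕ) [NeZero M] (hM : 2 ≤ M) (j k : ZMod M) (y : ℝ) :
    hatFn M k ((j.val : ℝ) / M + y) =
      hatW M (j + ((⌊(M : ℝ) * y⌋ : ℤ) : ZMod M) - k) (Int.fract ((M : ℝ) * y)) := by
  set n : ℤ := ⌊(M : ℝ) * y⌋ with hn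
  set f : ℝ := Int.fract ((M : ℝ) * y) with hf
  have hf0 : 0 ≤ f := Int.fract_nonneg _
  have hf1 : f < 1 := Int.fract_lt_one _
  have hy : (M : ℝ) * y = n + f := (Int.floor_add_fract _).symm
  have hM2 : (2 : ℝ) ≤ M := by exact_mod_cast hM
  have hM0 : (M : ℝ) ≠ 0 := by positivity
  have hMp : (0 : ℝ) < M := by positivity
  set d : ZMod M := j + (n : ZMod M) - k with hd
  have hdiv : (M : ℤ) ∣ ((j.val : ℤ) + n - k.val) - d.val := by
    rw [← ZMod.intCast_zmod_eq_zero_iff_dvd]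
    push_cast
    simp [hd]
  obtain ⟨m, hm⟩ := hdiv
  have hmR : ((j.val : ℝ) + n - k.val) - d.val = M * m := by exact_mod_cast hm
  have hdlt : d.val + 1 ≤ M := ZMod.val_lt d
  have hdR : (d.val : ℝ) + 1 ≤ M := by exact_mod_cast hdlt
  have hd0 : (0 : ℝ) ≤ d.val := by positivity
  have hx : (j.val : ℝ) / M + y - (k.val : ℝ) / M = ((d.val : ℝ) + f) / M + m := by
    field_simp
    linarith
  have hfr : Int.fract ((j.val : ℝ) / M + y - (k.val : ℝ) / M) = ((d.val : ℝ) + f) / M := by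
    rw [hx, Int.fract_add_intCast, Int.fract_eq_self]
    exact ⟨by positivity, by rw [div_lt_one hMp]; linarith⟩
  unfold hatFn
  rw [abs_sub_round_eq_min, hfr, mul_min_of_nonneg _ _ hMp.le]
  have e1 : (M : ℝ) * (((d.val : ℝ) + f) / M) = d.val + f := by field_simp
  have e2 : (M : ℝ) * (1 - ((d.val : ℝ) + f) / M) = M - (d.val + f) := by field_simp
  rw [e1, e2]
  unfold hatW
  have h0 : d = 0 ↔ d.val = 0 := (ZMod.val_eq_zero d).symm
  have h1 : d = -1 ↔ d.val + 1 = M := by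
    constructor
    · intro h
      have : Fact (1 < M) := ⟨hM⟩
      have : d.val = M - 1 := by
        rw [h, ZMod.neg_val, if_neg one_ne_zero, ZMod.val_one]
      omega
    · intro h
      have : ((d.val + 1 : ℕ) : ZMod M) = 0 := by rw [h]; simp
      push_cast at this
      rw [ZMod.natCast_zmod_val] at this
      exact eq_neg_of_add_eq_zero_left this
  simp only [h0, h1]
  by_cases c0 : d.val = 0
  · have : ¬ (d.val + 1 = M) := by omega
    rw [if_pos c0, if_neg this, c0]
    rw [min_eq_left (by push_cast; linarith), max_eq_right (by push_cast; linarith)]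
    push_cast; ring
  · have hd1 : (1 : ℝ) ≤ d.val := by exact_mod_cast Nat.one_le_iff_ne_zero.mpr c0
    rw [if_neg c0]
    by_cases c1 : d.val + 1 = M
    · have c1R : (d.val : ℝ) + 1 = M := by exact_mod_cast c1
      rw [if_pos c1, min_eq_right (by linarith), max_eq_right (by linarith)]
      linarith
    · have c2 : d.val + 2 ≤ M := by omega
      have c2R : (d.val : ℝ) + 2 ≤ M := by exact_mod_cast c2
      rw [if_neg c1, max_eq_left]
      · ring
      · have : 1 ≤ min ((d.val : ℝ) + f) (M - (d.val + f)) :=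
          le_min (by linarith) (by linarith)
        linarith

lemma sum_hatW (M : ℕ) [NeZero M] (f : ℝ) : ∑ d : ZMod M, hatW M d f = 1 := by
  simp [hatW, Finset.sum_add_distrib]

lemma hatFn_nonneg (M : ℕ) (k : ZMod M) (x : ℝ) : 0 ≤ hatFn M k x := le_max_left _ _

lemma hatFn_le_one (M : ℕ) (k : ZMod M) (x : ℝ) : hatFn M k x ≤ 1 := by
  unfold hatFn
  refine max_le zero_le_one ?_
  have : 0 ≤ (M : ℝ) * |(x - (k.val : ℝ) / M) - ((round (x - (k.val : ℝ) / M) : ℤ) : ℝ)| := by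
    positivity
  linarith

lemma measurable_hatFn (M : ℕ) (k : ZMod M) : Measurable (hatFn M k) := by
  unfold hatFn
  simp only [abs_sub_round_eq_min]
  have h : Measurable fun x : ℝ => Int.fract (x - (k.val : ℝ) / M) :=
    measurable_fract.comp (measurable_id.sub_const _)
  exact measurable_const.max (measurable_const.sub
    ((h.min (measurable_const.sub h)).const_mul _))

lemma integrable_hatFn (M : ℕ) (k : ZMod M) (a : ℝ) (v : NNReal) :
    Integrable (fun y => hatFn M k (a + y)) (gaussianReal 0 v) := by
  refine Integrable.of_bound (C := 1)
    ((measurable_hatFn M k).comp (measurable_const_add a)).aestronglyMeasurable ?_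
  refine Filter.Eventually.of_forall fun y => ?_
  rw [Real.norm_eq_abs, abs_of_nonneg (hatFn_nonneg _ _ _)]
  exact hatFn_le_one _ _ _

lemma Qmat_shift (M : ℕ) [NeZero M] (hM : 2 ≤ M) (δt : ℝ) (j d : ZMod M) :
    Qmat M δt j (j - d) = Qmat M δt 0 (-d) := by
  unfold Qmat
  simp only [hatFn_eq M hM]
  congr 1
  ext y
  congr 1
  ring

lemma Qmat_sum (M : ℕ) [NeZero M] (hM : 2 ≤ M) (δt : ℝ) :
    ∑ d : ZMod M, Qmat M δt 0 (-d) = 1 := by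
  unfold Qmat
  rw [← integral_finsetSum _ (fun k _ => integrable_hatFn M _ _ _)]
  have : ∀ y : ℝ, ∑ d : ZMod M, hatFn M (-d) (((0 : ZMod M).val : ℝ) / M + y) = 1 := by
    intro y
    simp only [hatFn_eq M hM]
    rw [← sum_hatW M (Int.fract ((M : ℝ) * y))]
    refine Fintype.sum_equiv (Equiv.addLeft ((⌊(M : ℝ) * y⌋ : ℤ) : ZMod M)) _ _ fun d => ?_
    simp
  simp only [this]
  simp

lemma Qmat_mulVec (M : ℕ) [NeZero M] (hM : 2 ≤ M) (δt : ℝ) (u : ZMod M → ℝ) (j : ZMod M) :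
    (Qmat M δt).mulVec u j = ∑ d : ZMod M, Qmat M δt 0 (-d) * u (j - d) := by
  simp only [Matrix.mulVec, dotProduct]
  refine (Fintype.sum_equiv (Equiv.subLeft j) _ _ fun d => ?_).symm
  simp [Qmat_shift M hM]

lemma Q_sum_sq (M : ℕ) [NeZero M] (hM : 2 ≤ M) (δt : ℝ) (u : ZMod M → ℝ) :
    ∑ j, ((Qmat M δt).mulVec u j) ^ 2 ≤ ∑ j, (u j) ^ 2 := by
  have hq : ∀ d : ZMod M, 0 ≤ Qmat M δt 0 (-d) := fun d =>
    integral_nonneg fun y => hatFn_nonneg _ _ _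
  calc ∑ j, ((Qmat M δt).mulVec u j) ^ 2
      ≤ ∑ j, ∑ d : ZMod M, Qmat M δt 0 (-d) * (u (j - d)) ^ 2 := by
        refine Finset.sum_le_sum fun j _ => ?_
        rw [Qmat_mulVec M hM]
        have := (even_two.convexOn_pow (𝕜 := ℝ)).map_sum_le (t := Finset.univ)
          (w := fun d : ZMod M => Qmat M δt 0 (-d)) (p := fun d => u (j - d))
          (fun d _ => hq d) (Qmat_sum M hM δt) (fun _ _ => Set.mem_univ _)
        simpa using this
    _ = ∑ d : ZMod M, Qmat M δt 0 (-d) * ∑ j, (u j) ^ 2 := by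
        rw [Finset.sum_comm]
        refine Finset.sum_congr rfl fun d _ => ?_
        rw [← Finset.mul_sum]
        congr 1
        exact Fintype.sum_equiv (Equiv.subRight d) _ _ fun j => by simp
    _ = ∑ j, (u j) ^ 2 := by rw [← Finset.sum_mul, Qmat_sum M hM, one_mul]

/-- Proposition 3.3: the matrix `Q` contracts both the discrete `ℓ²` norm and the discrete
`h¹` seminorm: `‖Q u‖_{ℓ²} ≤ ‖u‖_{ℓ²}` and `|Q u|_{h¹} ≤ |u|_{h¹}`. -/
theorem Q_l2_h1_contraction (M : ℕ) [NeZero M] (hM : 2 ≤ M) (δt : ℝ) (hδt : 0 < δt)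
    (u : ZMod M → ℝ) :
    Real.sqrt (l2sq M ((Qmat M δt).mulVec u)) ≤ Real.sqrt (l2sq M u) ∧
    Real.sqrt (h1sq M ((Qmat M δt).mulVec u)) ≤ Real.sqrt (h1sq M u) := by
  constructor
  · refine Real.sqrt_le_sqrt ?_
    unfold l2sq
    exact mul_le_mul_of_nonneg_left (Q_sum_sq M hM δt u) (by positivity)
  · refine Real.sqrt_le_sqrt ?_
    unfold h1sq
    refine mul_le_mul_of_nonneg_left ?_ (by positivity)
    refine le_of_eq_of_le ?_
      (Q_sum_sq M hM δt (fun j => (u (j + 1) - u j) / (1 / M : ℝ)))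
    refine Finset.sum_congr rfl fun j _ => ?_
    rw [Qmat_mulVec M hM, Qmat_mulVec M hM, Qmat_mulVec M hM, ← Finset.sum_sub_distrib,
      Finset.sum_div]
    congr 1
    refine Finset.sum_congr rfl fun d _ => ?_
    rw [show j + 1 - d = j - d + 1 by ring]
    ring
end

section
/- Gaussian smoothing of hat functions: for every T > 0 there exists a constant C > 0 such that for every integer M ≥ 2 (with δx = 1/M), every δt > 0, every integer ℓ with 1 ≤ ℓ and ℓ δt ≤ T, and every j ∈ ℤ/M, one has ∫_ℝ φ_j(x_j + y) dγ_{2ℓδt}(y) ≤ C δx / √(2ℓδt), where γ_{s} is the centered Gaussian measure on ℝ with variance s. -/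
open MeasureTheory ProbabilityTheory Real Finset

theorem hat_aux_summable : Summable (fun n : ℤ => 1 / (1 + (n : ℝ) ^ 2)) := by
  have h1 : Summable (fun n : ℤ => 1 / (n : ℝ) ^ 2) :=
    Real.summable_one_div_int_pow.mpr (by norm_num)
  have h2 : Summable (fun n : ℤ => if n = 0 then (1 : ℝ) else 0) :=
    (hasSum_ite_eq (0 : ℤ) (1 : ℝ)).summable
  refine Summable.of_nonneg_of_le (fun n => by positivity) (fun n => ?_) (h1.add h2)
  by_cases hn : n = 0
  · simp [hn]
  · simp only [hn, if_false, add_zero]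
    have : (0 : ℝ) < (n : ℝ) ^ 2 := by positivity
    exact one_div_le_one_div_of_le this (by linarith)

theorem hat_aux_pdf (T s y : ℝ) (n : ℤ) (hT : 0 < T) (hs : 0 < s) (hsT : s ≤ 2 * T)
    (hy : |y - n| ≤ 1) :
    gaussianPDFReal 0 s.toNNReal y ≤ (3 + 8 * T) / √s * (1 / (1 + (n : ℝ) ^ 2)) := by
  have hss : 0 < √s := Real.sqrt_pos.mpr hs
  rw [gaussianPDFReal, Real.coe_toNNReal _ hs.le, sub_zero]
  have h1 : (√(2 * π * s))⁻¹ ≤ 1 / √s := by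
    rw [← one_div]
    apply one_div_le_one_div_of_le hss
    apply Real.sqrt_le_sqrt
    nlinarith [Real.pi_gt_three]
  have h2 : Real.exp (-y ^ 2 / (2 * s)) ≤ (3 + 8 * T) * (1 / (1 + (n : ℝ) ^ 2)) := by
    have h3 : -y ^ 2 / (2 * s) ≤ -(y ^ 2 / (4 * T)) := by
      rw [neg_div]
      apply neg_le_neg
      apply div_le_div_of_nonneg_left (by positivity) (by positivity) (by linarith)
    have h4 : y ^ 2 / (4 * T) + 1 ≤ Real.exp (y ^ 2 / (4 * T)) := Real.add_one_le_exp _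
    have h5 : (n : ℝ) ^ 2 ≤ 2 * y ^ 2 + 2 := by
      have := abs_le.mp hy
      nlinarith [sq_nonneg (2 * y - n)]
    have h6 : (1 + (n : ℝ) ^ 2) ≤ (3 + 8 * T) * (y ^ 2 / (4 * T) + 1) := by
      have : (3 + 8 * T) * (y ^ 2 / (4 * T) + 1) = 3 * (y ^ 2 / (4 * T)) + 2 * y ^ 2 + 3 + 8 * T := by
        field_simp
        ring
      rw [this]
      have : 0 ≤ y ^ 2 / (4 * T) := by positivity
      linarith
    calc Real.exp (-y ^ 2 / (2 * s)) ≤ Real.exp (-(y ^ 2 / (4 * T))) := Real.exp_le_exp.mpr h3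
      _ = 1 / Real.exp (y ^ 2 / (4 * T)) := by rw [Real.exp_neg, one_div]
      _ ≤ _ := by
        rw [mul_one_div, div_le_div_iff₀ (Real.exp_pos _) (by positivity), one_mul]
        exact h6.trans (mul_le_mul_of_nonneg_left h4 (by positivity))
  calc _ ≤ 1 / √s * ((3 + 8 * T) * (1 / (1 + (n : ℝ) ^ 2))) :=
        mul_le_mul h1 h2 (Real.exp_pos _).le (by positivity)
    _ = _ := by ring

theorem hat_aux_measure (T s r : ℝ) (n : ℤ) (hT : 0 < T) (hs : 0 < s) (hsT : s ≤ 2 * T)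
    (hr : 0 < r) (hr1 : r ≤ 1) :
    gaussianReal 0 s.toNNReal (Set.Icc ((n : ℝ) - r) (n + r)) ≤
      ENNReal.ofReal ((3 + 8 * T) / √s * (2 * r) * (1 / (1 + (n : ℝ) ^ 2))) := by
  have hv : s.toNNReal ≠ 0 := by simpa using hs
  rw [gaussianReal_apply 0 hv]
  calc _ ≤ ∫⁻ y in Set.Icc ((n : ℝ) - r) (n + r),
          ENNReal.ofReal ((3 + 8 * T) / √s * (1 / (1 + (n : ℝ) ^ 2))) := by
        apply setLIntegral_mono' measurableSet_Icc
        intro y hy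
        apply ENNReal.ofReal_le_ofReal
        apply hat_aux_pdf T s y n hT hs hsT
        rw [abs_le]
        constructor <;> linarith [hy.1, hy.2]
    _ = _ := by
        rw [setLIntegral_const, Real.volume_Icc, ← ENNReal.ofReal_mul (by positivity)]
        congr 1
        ring

/-- Lemma 4.3, second estimate (Gaussian smoothing of hat functions): for every `T > 0`
there is `C > 0` such that for every `δx = 1/M`, every `δt > 0`, every `ℓ ≥ 1` with
`ℓ δt ≤ T`, and every `j`, `∫ φ_j(x_j + y) dγ_{2ℓδt}(y) ≤ C δx / √(2ℓδt)`. -/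
theorem gaussian_smoothing_hat (T : ℝ) (hT : 0 < T) : ∃ C : ℝ, 0 < C ∧
    ∀ (M : ℕ) [NeZero M], 2 ≤ M → ∀ (δt : ℝ), 0 < δt →
    ∀ (ℓ : ℕ), 1 ≤ ℓ → (ℓ : ℝ) * δt ≤ T → ∀ j : ZMod M,
      ∫ y, hatFn M j ((j.val : ℝ) / M + y) ∂(gaussianReal 0 (2 * ℓ * δt).toNNReal)
        ≤ C * (1 / M : ℝ) / Real.sqrt (2 * ℓ * δt) := by
  refine ⟨(3 + 8 * T) * 2 * ∑' n : ℤ, 1 / (1 + (n : ℝ) ^ 2), ?_, ?_⟩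
  · have : 0 < ∑' n : ℤ, 1 / (1 + (n : ℝ) ^ 2) :=
      hat_aux_summable.tsum_pos (fun n => by positivity) 0 (by norm_num)
    positivity
  intro M _ hM δt hδ ℓ hℓ hle j
  have hℓ' : (1 : ℝ) ≤ ℓ := by exact_mod_cast hℓ
  have hM' : (2 : ℝ) ≤ M := by exact_mod_cast hM
  have hMpos : (0 : ℝ) < M := by linarith
  have hs : 0 < 2 * (ℓ : ℝ) * δt := by positivity
  have hsT : 2 * (ℓ : ℝ) * δt ≤ 2 * T := by linarith
  set s := 2 * (ℓ : ℝ) * δt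
  have hr : 0 < 1 / (M : ℝ) := by positivity
  have hr1 : 1 / (M : ℝ) ≤ 1 := by
    rw [div_le_one hMpos]
    linarith
  have hsum := hat_aux_summable.mul_left ((3 + 8 * T) / √s * (2 * (1 / (M : ℝ))))
  have hS : 0 ≤ ∑' n : ℤ, 1 / (1 + (n : ℝ) ^ 2) := tsum_nonneg fun n => by positivity
  have hmeas : MeasurableSet (⋃ n : ℤ, Set.Icc ((n : ℝ) - 1 / M) (n + 1 / M)) :=
    MeasurableSet.iUnion fun n => measurableSet_Icc
  have key : ∫⁻ y, ENNReal.ofReal ‖hatFn M j ((j.val : ℝ) / M + y)‖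
      ∂(gaussianReal 0 s.toNNReal) ≤
      ENNReal.ofReal ((3 + 8 * T) / √s * (2 * (1 / (M : ℝ))) *
        ∑' n : ℤ, 1 / (1 + (n : ℝ) ^ 2)) := by
    calc _ ≤ ∫⁻ y, (⋃ n : ℤ, Set.Icc ((n : ℝ) - 1 / M) (n + 1 / M)).indicator 1 y
            ∂(gaussianReal 0 s.toNNReal) := by
          apply lintegral_mono
          intro y
          simp only [hatFn, add_sub_cancel_left]
          by_cases hy : y ∈ ⋃ n : ℤ, Set.Icc ((n : ℝ) - 1 / M) (n + 1 / M)
          · rw [Set.indicator_of_mem hy, Pi.one_apply, ENNReal.ofReal_le_one,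
              Real.norm_of_nonneg (le_max_left _ _)]
            apply max_le zero_le_one
            have : 0 ≤ (M : ℝ) * |y - (round y : ℤ)| := by positivity
            linarith
          · rw [Set.indicator_of_notMem hy, max_eq_left]
            · simp
            · by_contra hc
              push Not at hc
              apply hy
              rw [Set.mem_iUnion]
              refine ⟨round y, ?_⟩
              have h1 : |y - (round y : ℤ)| < 1 / M := by
                rw [lt_div_iff₀ hMpos]
                linarith
              have h2 := abs_lt.mp h1
              constructor <;> linarith [h2.1, h2.2]
      _ = gaussianReal 0 s.toNNReal (⋃ n : ℤ, Set.Icc ((n : ℝ) - 1 / M) (n + 1 / M)) :=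
          lintegral_indicator_one hmeas
      _ ≤ ∑' n : ℤ, gaussianReal 0 s.toNNReal (Set.Icc ((n : ℝ) - 1 / M) (n + 1 / M)) :=
          measure_iUnion_le _
      _ ≤ ∑' n : ℤ, ENNReal.ofReal
            ((3 + 8 * T) / √s * (2 * (1 / (M : ℝ))) * (1 / (1 + (n : ℝ) ^ 2))) :=
          ENNReal.tsum_le_tsum fun n => hat_aux_measure T s _ n hT hs hsT hr hr1
      _ = _ := by
          rw [← ENNReal.ofReal_tsum_of_nonneg (fun n => by positivity) hsum, tsum_mul_left]
  calc _ ≤ ‖∫ y, hatFn M j ((j.val : ℝ) / M + y) ∂(gaussianReal 0 s.toNNReal)‖ :=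
        Real.le_norm_self _
    _ ≤ _ := norm_integral_le_lintegral_norm _
    _ ≤ _ := ENNReal.toReal_le_of_le_ofReal (by positivity) key
    _ = _ := by ring
end

section
/- Sum bound for diagonal entries of powers of Q: for every T > 0 there exists a constant C > 0 such that for every integer M_T ≥ 2 (with δt = T/M_T), every integer M ≥ 2 (with δx = 1/M), and every 1 ≤ n ≤ M_T, one has Σ_{k=0}^{n−1} (Q^{2(n−1−k)})_{0,0} ≤ C (1 + δx/δt + (δx²/δt²)(1 + |log δt|)), where (Q⁰)_{0,0} = 1. -/
open MeasureTheory ProbabilityTheory Real Finset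

lemma hasSum_b2 {x : ℝ} (h0 : 0 ≤ x) (h1 : x ≤ 1) :
    HasSum (fun n : ℕ => 1 / (n : ℝ) ^ 2 * Real.cos (2 * π * n * x))
      (π ^ 2 * (x ^ 2 - x + 1 / 6)) := by
  have h := hasSum_one_div_nat_pow_mul_cos (k := 1) one_ne_zero (x := x) ⟨h0, h1⟩
  convert h using 1
  have : (Polynomial.bernoulli 2) = Polynomial.X ^ 2 - Polynomial.X + Polynomial.C (1 / 6) := by
    simp [Polynomial.bernoulli, Finset.sum_range_succ, ← Polynomial.X_pow_eq_monomial]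
    ring
  simp [this]
  ring_nf
  simp

noncomputable def coefA (M n : ℕ) : ℝ :=
  (if n = 0 then 1 / (M : ℝ) else 0) + 2 * M / π ^ 2 * (1 / (n : ℝ) ^ 2 * Real.sin (π * n / M) ^ 2)

lemma coefA_nonneg (M n : ℕ) : 0 ≤ coefA M n := by
  unfold coefA; split_ifs <;> positivity

lemma hat_core (M : ℕ) (hM : 2 ≤ M) (d : ℝ) (h0 : 0 ≤ d) (h1 : d ≤ 1 / 2) :
    HasSum (fun n : ℕ => coefA M n * Real.cos (2 * π * n * d)) (max 0 (1 - M * d)) := by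
  have hM' : (2 : ℝ) ≤ M := by exact_mod_cast hM
  have hMpos : (0 : ℝ) < M := by linarith
  have hh : 1 / (M : ℝ) ≤ 1 / 2 := by
    apply one_div_le_one_div_of_le <;> linarith
  have hh0 : 0 < 1 / (M : ℝ) := by positivity
  have s1 := hasSum_b2 h0 (by linarith)
  have s2 := hasSum_b2 (x := d + 1 / M) (by linarith) (by linarith)
  have s3 := hasSum_b2 (x := |d - 1 / M|) (abs_nonneg _) (by rw [abs_le]; constructor <;> linarith)
  have s4 : HasSum (fun n : ℕ => if n = 0 then 1 / (M : ℝ) else 0) (1 / M) := hasSum_ite_eq 0 _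
  have s := s4.add ((((s1.mul_left 2).sub s2).sub s3).mul_left (M / (2 * π ^ 2)))
  convert s using 1
  · ext n
    have e3 : Real.cos (2 * π * n * |d - 1 / M|) = Real.cos (2 * π * n * (d - 1 / M)) := by
      rcases abs_cases (d - 1 / (M : ℝ)) with ⟨h, _⟩ | ⟨h, _⟩ <;> rw [h]
      rw [mul_neg, Real.cos_neg]
    rw [e3]
    have e4 : Real.sin (π * n / M) ^ 2 * Real.cos (2 * π * n * d) =
        (2 * Real.cos (2 * π * n * d) - Real.cos (2 * π * n * (d + 1 / M))
          - Real.cos (2 * π * n * (d - 1 / M))) / 4 := by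
      have a1 : 2 * π * n * (d + 1 / M) = 2 * π * n * d + 2 * (π * n / M) := by ring
      have a2 : 2 * π * n * (d - 1 / M) = 2 * π * n * d - 2 * (π * n / M) := by ring
      rw [a1, a2, Real.cos_add, Real.cos_sub, Real.cos_two_mul, Real.cos_sq']
      ring
    unfold coefA
    rw [add_mul, mul_assoc (2 * (M : ℝ) / π ^ 2), mul_assoc (1 / (n : ℝ) ^ 2), e4]
    congr 1
    · split_ifs with h <;> simp [h]
    · field_simp
      ring
  · have hp : π ≠ 0 := Real.pi_ne_zero
    have e : 1 / (M : ℝ) + M / (2 * π ^ 2) * (2 * (π ^ 2 * (d ^ 2 - d + 1 / 6)) -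
        π ^ 2 * ((d + 1 / M) ^ 2 - (d + 1 / M) + 1 / 6) -
        π ^ 2 * (|d - 1 / M| ^ 2 - |d - 1 / M| + 1 / 6))
        = M / 2 * (-d + 1 / M + |d - 1 / M|) := by
      rw [sq_abs]; field_simp; ring
    rw [e]
    have hm : (M : ℝ) * (1 / M) = 1 := by field_simp
    rcases abs_cases (d - 1 / (M : ℝ)) with ⟨h, h'⟩ | ⟨h, h'⟩ <;> rw [h]
    · rw [max_eq_left (by nlinarith)]; ring
    · rw [max_eq_right (by nlinarith)]; linear_combination -hm

lemma hat_hasSum (M : ℕ) (hM : 2 ≤ M) (k : ZMod M) (x : ℝ) :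
    HasSum (fun n : ℕ => coefA M n * Real.cos (2 * π * n * (x - (k.val : ℝ) / M)))
      (hatFn M k x) := by
  unfold hatFn
  set t := x - (k.val : ℝ) / M
  convert hat_core M hM |t - (round t : ℤ)| (abs_nonneg _) (abs_sub_round t) using 1
  ext n
  congr 1
  have e3 : Real.cos (2 * π * n * |t - (round t : ℤ)|) =
      Real.cos (2 * π * n * (t - (round t : ℤ))) := by
    rcases abs_cases (t - (round t : ℤ)) with ⟨h, _⟩ | ⟨h, _⟩ <;> rw [h]
    rw [mul_neg, Real.cos_neg]
  rw [e3]
  have : 2 * π * n * (t - (round t : ℤ)) = 2 * π * n * t - ((n * round t : ℤ) : ℝ) * (2 * π) := by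
    push_cast; ring
  rw [this, Real.cos_sub_int_mul_two_pi]

lemma coefA_summable (M : ℕ) (hM : 2 ≤ M) : Summable (coefA M) := by
  have := (hat_core M hM 0 le_rfl (by norm_num)).summable
  simpa using this

lemma sum_zmod_val (M : ℕ) [NeZero M] (f : ℕ → ℝ) :
    ∑ k : ZMod M, f k.val = ∑ i ∈ Finset.range M, f i := by
  cases M with
  | zero => exact absurd rfl (NeZero.ne 0)
  | succ m => exact Fin.sum_univ_eq_sum_range f (m + 1)

lemma orth (M : ℕ) (hM : 0 < M) (a : ℝ) (d : ℤ) :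
    ∑ i ∈ Finset.range M, Real.cos (a + 2 * π * d * i / M) =
      if (M : ℤ) ∣ d then M * Real.cos a else 0 := by
  have hMr : (M : ℝ) ≠ 0 := by positivity
  have hMc : (M : ℂ) ≠ 0 := by exact_mod_cast hM.ne'
  split_ifs with h
  · obtain ⟨c, rfl⟩ := h
    have : ∀ i ∈ Finset.range M, Real.cos (a + 2 * π * ((M * c : ℤ) : ℝ) * i / M) = Real.cos a := by
      intro i _
      have : a + 2 * π * ((M * c : ℤ) : ℝ) * i / M = a + ((c * i : ℤ) : ℝ) * (2 * π) := by
        push_cast; field_simp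
      rw [this, Real.cos_add_int_mul_two_pi]
    rw [Finset.sum_congr rfl this]; simp
  · set z : ℂ := Complex.exp (2 * π * Complex.I * d / M) with hz
    have hz1 : z ≠ 1 := by
      intro h1
      obtain ⟨c, hc⟩ := Complex.exp_eq_one_iff.1 h1
      apply h
      refine ⟨c, ?_⟩
      have h2 : (2 * (π : ℂ) * Complex.I) ≠ 0 := Complex.two_pi_I_ne_zero
      have : (d : ℂ) = M * c := by
        field_simp at hc
        apply mul_left_cancel₀ h2
        linear_combination (2 * (π : ℂ) * Complex.I) * hc
      exact_mod_cast this
    have hzM : z ^ M = 1 := by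
      rw [hz, ← Complex.exp_nat_mul, Complex.exp_eq_one_iff]
      exact ⟨d, by field_simp⟩
    have hg : ∑ i ∈ Finset.range M, z ^ i = 0 := by
      rw [geom_sum_eq hz1, hzM]; simp
    have : ∀ i ∈ Finset.range M, Real.cos (a + 2 * π * d * i / M) =
        (Complex.exp (a * Complex.I) * z ^ i).re := by
      intro i _
      rw [hz, ← Complex.exp_nat_mul, ← Complex.exp_add]
      have : (a : ℂ) * Complex.I + i * (2 * π * Complex.I * d / M) =
        ((a + 2 * π * d * i / M : ℝ) : ℂ) * Complex.I := by push_cast; ring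
      rw [this, Complex.exp_ofReal_mul_I_re]
    rw [Finset.sum_congr rfl this, ← Complex.re_sum, ← Finset.mul_sum, hg]; simp

noncomputable def wgt (M n p : ℕ) : ℝ :=
  M / 2 * ((if (M : ℤ) ∣ (p : ℤ) - n then 1 else 0) + (if (M : ℤ) ∣ (p : ℤ) + n then 1 else 0))

lemma wgt_nonneg (M n p : ℕ) : 0 ≤ wgt M n p := by
  unfold wgt; split_ifs <;> positivity

lemma wgt_le (M n p : ℕ) : wgt M n p ≤ M := by
  have : (0 : ℝ) ≤ M := by positivity
  unfold wgt; split_ifs <;> linarith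

lemma wgt_sum (M : ℕ) [NeZero M] (n p : ℕ) (x : ℝ) :
    ∑ k : ZMod M, Real.cos (2 * π * n * (x - (k.val : ℝ) / M)) * Real.cos (2 * π * p * k.val / M)
      = wgt M n p * Real.cos (2 * π * n * x) := by
  have hM : 0 < M := Nat.pos_of_ne_zero (NeZero.ne M)
  rw [sum_zmod_val M (fun i => Real.cos (2 * π * n * (x - (i : ℝ) / M)) *
    Real.cos (2 * π * p * i / M))]
  have o1 := orth M hM (2 * π * n * x) ((p : ℤ) - n)
  have o2 := orth M hM (-(2 * π * n * x)) ((p : ℤ) + n)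
  rw [Real.cos_neg] at o2
  have : ∀ i ∈ Finset.range M, Real.cos (2 * π * n * (x - (i : ℝ) / M)) *
    Real.cos (2 * π * p * i / M) = (Real.cos (2 * π * n * x + 2 * π * (((p : ℤ) - n : ℤ) : ℝ) * i / M)
      + Real.cos (-(2 * π * n * x) + 2 * π * (((p : ℤ) + n : ℤ) : ℝ) * i / M)) / 2 := by
    intro i _
    have e1 : 2 * π * n * x + 2 * π * (((p : ℤ) - n : ℤ) : ℝ) * i / M =
      2 * π * p * i / M + 2 * π * n * (x - (i : ℝ) / M) := by push_cast; ring
    have e2 : -(2 * π * n * x) + 2 * π * (((p : ℤ) + n : ℤ) : ℝ) * i / M =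
      2 * π * p * i / M - 2 * π * n * (x - (i : ℝ) / M) := by push_cast; ring
    rw [e1, e2, Real.cos_add, Real.cos_sub]; ring
  rw [Finset.sum_congr rfl this, ← Finset.sum_div, Finset.sum_add_distrib, o1, o2]
  unfold wgt
  split_ifs <;> ring

lemma wgt_cos (M : ℕ) [NeZero M] (n p j : ℕ) :
    wgt M n p * Real.cos (2 * π * n * (j / M)) = wgt M n p * Real.cos (2 * π * p * j / M) := by
  have hM : (M : ℝ) ≠ 0 := Nat.cast_ne_zero.2 (NeZero.ne M)
  unfold wgt
  by_cases h1 : (M : ℤ) ∣ (p : ℤ) - n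
  · obtain ⟨c, hc⟩ := h1
    have hp : (p : ℝ) = n + M * c := by
      have : ((p : ℤ) : ℝ) = ((n + M * c : ℤ) : ℝ) := by rw [← hc]; push_cast; ring
      push_cast at this; exact this
    have : 2 * π * p * j / M = 2 * π * n * (j / M) + ((c * j : ℤ) : ℝ) * (2 * π) := by
      rw [hp]; push_cast; field_simp
    rw [this, Real.cos_add_int_mul_two_pi]
  · by_cases h2 : (M : ℤ) ∣ (p : ℤ) + n
    · obtain ⟨c, hc⟩ := h2
      have hp : (p : ℝ) = M * c - n := by
        have : ((p : ℤ) : ℝ) = ((M * c - n : ℤ) : ℝ) := by rw [← hc]; push_cast; ring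
        push_cast at this; exact this
      have : 2 * π * p * j / M = -(2 * π * n * (j / M)) + ((c * j : ℤ) : ℝ) * (2 * π) := by
        rw [hp]; push_cast; field_simp; ring
      rw [this, Real.cos_add_int_mul_two_pi, Real.cos_neg]
    · simp [h1, h2]

lemma wgt_ne_zero (M : ℕ) (n p : ℕ) (hp : p < M) (h : wgt M n p ≠ 0) : p ≤ n ∨ M - p ≤ n := by
  unfold wgt at h
  by_cases h1 : (M : ℤ) ∣ (p : ℤ) - n
  · left
    by_contra hn
    have := Int.le_of_dvd (by omega) h1
    omega
  · by_cases h2 : (M : ℤ) ∣ (p : ℤ) + n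
    · by_cases h3 : p + n = 0
      · left; omega
      · right
        have := Int.le_of_dvd (by omega) h2
        omega
    · simp [h1, h2] at h

lemma interp_hasSum (M : ℕ) [NeZero M] (hM : 2 ≤ M) (p : ℕ) (x : ℝ) :
    HasSum (fun n : ℕ => coefA M n * wgt M n p * Real.cos (2 * π * n * x))
      (∑ k : ZMod M, hatFn M k x * Real.cos (2 * π * p * k.val / M)) := by
  have := hasSum_sum (s := (Finset.univ : Finset (ZMod M))) (fun k _ =>
    (hat_hasSum M hM k x).mul_right (Real.cos (2 * π * p * k.val / M)))
  have e : (fun n : ℕ => coefA M n * wgt M n p * Real.cos (2 * π * n * x)) = fun n : ℕ =>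
      ∑ k : ZMod M, coefA M n * Real.cos (2 * π * n * (x - (k.val : ℝ) / M)) *
        Real.cos (2 * π * p * k.val / M) := by
    funext n
    rw [mul_assoc, ← wgt_sum, Finset.mul_sum]
    exact Finset.sum_congr rfl fun k _ => by ring
  rw [e]
  exact this

lemma hat_zero (M : ℕ) [NeZero M] (k : ZMod M) : hatFn M k 0 = if k = 0 then 1 else 0 := by
  have hM : (0 : ℝ) < M := Nat.cast_pos.2 (Nat.pos_of_ne_zero (NeZero.ne M))
  unfold hatFn
  split_ifs with h
  · simp [h]
  · apply max_eq_left
    set r := round (0 - (k.val : ℝ) / M)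
    have hv : k.val ≠ 0 := by rwa [Ne, ZMod.val_eq_zero]
    have hlt := ZMod.val_lt k
    have e : (M : ℝ) * |0 - (k.val : ℝ) / M - r| = ((|(k.val : ℤ) + M * r| : ℤ) : ℝ) := by
      rw [← abs_of_pos hM, ← abs_mul, abs_of_pos hM, ← abs_neg]
      push_cast
      congr 1; field_simp; ring
    rw [e]
    have : 1 ≤ |(k.val : ℤ) + M * r| := by
      apply Int.one_le_abs
      intro h0
      have : (M : ℤ) ∣ k.val := ⟨-r, by linarith⟩
      have := Int.le_of_dvd (by omega) this
      omega
    have : (1 : ℝ) ≤ ((|(k.val : ℤ) + M * r| : ℤ) : ℝ) := by exact_mod_cast this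
    linarith

lemma wsum_one (M : ℕ) [NeZero M] (hM : 2 ≤ M) (p : ℕ) :
    HasSum (fun n : ℕ => coefA M n * wgt M n p) 1 := by
  have := interp_hasSum M hM p 0
  simpa [hat_zero] using this

noncomputable def gau (s : ℝ) (n : ℕ) : ℝ := Real.exp (-(2 * π ^ 2 * n ^ 2 * s))

lemma gau_pos (s : ℝ) (n : ℕ) : 0 < gau s n := Real.exp_pos _

lemma gau_anti (s : ℝ) (hs : 0 ≤ s) {m n : ℕ} (h : m ≤ n) : gau s n ≤ gau s m := by
  unfold gau
  gcongr

lemma integral_cos_gauss (s : ℝ) (hs : 0 ≤ s) (n : ℕ) (c : ℝ) :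
    ∫ y, Real.cos (2 * π * n * (c + y)) ∂(gaussianReal 0 s.toNNReal) =
      gau s n * Real.cos (2 * π * n * c) := by
  have h := charFun_gaussianReal (μ := 0) (v := s.toNNReal) (2 * π * n)
  rw [charFun_apply_real] at h
  have h2 : ∫ y : ℝ, Complex.exp ((2 * π * n * c : ℝ) * Complex.I) *
      Complex.exp ((2 * π * n : ℝ) * y * Complex.I) ∂(gaussianReal 0 s.toNNReal) =
      Complex.exp ((2 * π * n * c : ℝ) * Complex.I) * (gau s n : ℂ) := by
    rw [integral_const_mul, h]
    congr 1
    unfold gau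
    rw [Complex.ofReal_exp, Real.coe_toNNReal _ hs]
    congr 1
    push_cast
    ring
  have hInt : Integrable (fun y : ℝ => Complex.exp ((2 * π * n * c : ℝ) * Complex.I) *
      Complex.exp ((2 * π * n : ℝ) * y * Complex.I)) (gaussianReal 0 s.toNNReal) := by
    refine Integrable.of_bound (C := 1) (by fun_prop) (Filter.Eventually.of_forall fun y => ?_)
    rw [norm_mul, Complex.norm_exp_ofReal_mul_I, ← Complex.ofReal_mul,
      Complex.norm_exp_ofReal_mul_I]
    norm_num
  have h3 := congrArg Complex.re h2
  have h4 := integral_re hInt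
  simp only [RCLike.re_eq_complex_re] at h4
  rw [← h4] at h3
  rw [mul_comm (gau s n), ← Complex.exp_ofReal_mul_I_re, ← Complex.re_mul_ofReal, ← h3]
  congr 1
  funext y
  rw [← Complex.exp_add]
  have : ((2 * π * n * c : ℝ) : ℂ) * Complex.I + (2 * π * n : ℝ) * y * Complex.I
    = ((2 * π * n * (c + y) : ℝ) : ℂ) * Complex.I := by push_cast; ring
  rw [this, Complex.exp_ofReal_mul_I_re]

lemma hat_meas (M : ℕ) (hM : 2 ≤ M) (k : ZMod M) : Measurable (hatFn M k) := by
  have : (hatFn M k) = fun x => ∑' n : ℕ, coefA M n * Real.cos (2 * π * n * (x - (k.val : ℝ) / M)) := by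
    funext x
    exact (hat_hasSum M hM k x).tsum_eq.symm
  rw [this]
  refine Continuous.measurable ?_
  refine continuous_tsum (u := coefA M) (fun n => by fun_prop) (coefA_summable M hM) ?_
  intro n x
  rw [norm_mul, Real.norm_eq_abs, Real.norm_eq_abs, abs_of_nonneg (coefA_nonneg M n)]
  exact mul_le_of_le_one_right (coefA_nonneg M n) (Real.abs_cos_le_one _)

lemma hat_bound (M : ℕ) (k : ZMod M) (x : ℝ) : ‖hatFn M k x‖ ≤ 1 := by
  unfold hatFn
  rw [Real.norm_eq_abs, abs_of_nonneg (le_max_left _ _)]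
  apply max_le (by norm_num)
  have : 0 ≤ (M : ℝ) * |(x - (k.val : ℝ) / M) - ((round (x - (k.val : ℝ) / M) : ℤ) : ℝ)| := by
    positivity
  linarith

noncomputable def lam (M : ℕ) (s : ℝ) (p : ℕ) : ℝ := ∑' n : ℕ, coefA M n * wgt M n p * gau s n

lemma Q_eigen (M : ℕ) [NeZero M] (hM : 2 ≤ M) (s : ℝ) (hs : 0 ≤ s) (p : ℕ) (j : ZMod M) :
    ∑ k : ZMod M, Qmat M s j k * Real.cos (2 * π * p * k.val / M) =
      lam M s p * Real.cos (2 * π * p * j.val / M) := by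
  have e1 : ∑ k : ZMod M, Qmat M s j k * Real.cos (2 * π * p * k.val / M) =
      ∫ y, ∑ k : ZMod M, hatFn M k ((j.val : ℝ) / M + y) * Real.cos (2 * π * p * k.val / M)
        ∂(gaussianReal 0 s.toNNReal) := by
    rw [integral_finsetSum]
    · refine Finset.sum_congr rfl fun k _ => ?_
      rw [integral_mul_const]; rfl
    · intro k _
      refine Integrable.mul_const ?_ _
      refine Integrable.of_bound (C := 1) ?_ (Filter.Eventually.of_forall fun y => hat_bound M k _)
      exact ((hat_meas M hM k).comp (by fun_prop)).aestronglyMeasurable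
  have hn : ∀ n, 0 ≤ coefA M n * wgt M n p := fun n =>
    mul_nonneg (coefA_nonneg M n) (wgt_nonneg M n p)
  have e2 := hasSum_integral_of_dominated_convergence (μ := gaussianReal 0 s.toNNReal)
    (F := fun (n : ℕ) (y : ℝ) => coefA M n * wgt M n p * Real.cos (2 * π * n * ((j.val : ℝ) / M + y)))
    (f := fun y => ∑ k : ZMod M, hatFn M k ((j.val : ℝ) / M + y) *
      Real.cos (2 * π * p * k.val / M))
    (fun n _ => coefA M n * wgt M n p)
    (fun n => by fun_prop)
    (fun n => Filter.Eventually.of_forall fun y => by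
      rw [norm_mul, Real.norm_eq_abs, Real.norm_eq_abs, abs_of_nonneg (hn n)]
      exact mul_le_of_le_one_right (hn n) (Real.abs_cos_le_one _))
    (Filter.Eventually.of_forall fun y => (wsum_one M hM p).summable)
    (integrable_const _)
    (Filter.Eventually.of_forall fun y => interp_hasSum M hM p _)
  rw [e1, ← e2.tsum_eq, lam, ← tsum_mul_right]
  congr 1
  funext n
  rw [integral_const_mul, integral_cos_gauss s hs]
  have := wgt_cos M n p j.val
  linear_combination (coefA M n * gau s n) * this

lemma lam_nonneg (M : ℕ) (s : ℝ) (p : ℕ) : 0 ≤ lam M s p :=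
  tsum_nonneg fun n => mul_nonneg (mul_nonneg (coefA_nonneg M n) (wgt_nonneg M n p)) (gau_pos s n).le

lemma lam_le (M : ℕ) [NeZero M] (hM : 2 ≤ M) (s : ℝ) (hs : 0 ≤ s) (p : ℕ) (hp : p < M) :
    lam M s p ≤ max (gau s p) (gau s (M - p)) := by
  have h1 := (wsum_one M hM p).mul_right (max (gau s p) (gau s (M - p)))
  have hle : ∀ n, coefA M n * wgt M n p * gau s n ≤
      coefA M n * wgt M n p * max (gau s p) (gau s (M - p)) := by
    intro n
    by_cases hw : wgt M n p = 0
    · simp [hw]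
    · refine mul_le_mul_of_nonneg_left ?_ (mul_nonneg (coefA_nonneg M n) (wgt_nonneg M n p))
      rcases wgt_ne_zero M n p hp hw with h | h
      · exact (gau_anti s hs h).trans (le_max_left _ _)
      · exact (gau_anti s hs h).trans (le_max_right _ _)
  have h2 : Summable fun n => coefA M n * wgt M n p * gau s n :=
    Summable.of_nonneg_of_le (fun n => mul_nonneg (mul_nonneg (coefA_nonneg M n) (wgt_nonneg M n p))
      (gau_pos s n).le) hle h1.summable
  have := h2.tsum_le_tsum hle h1.summable
  rw [h1.tsum_eq, one_mul] at this
  exact this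

lemma Q_pow_eigen (M : ℕ) [NeZero M] (hM : 2 ≤ M) (s : ℝ) (hs : 0 ≤ s) (p r : ℕ) (j : ZMod M) :
    ∑ k : ZMod M, (Qmat M s ^ r) j k * Real.cos (2 * π * p * k.val / M) =
      lam M s p ^ r * Real.cos (2 * π * p * j.val / M) := by
  have key : (Qmat M s ^ r).mulVec (fun k => Real.cos (2 * π * p * k.val / M)) =
      lam M s p ^ r • (fun k : ZMod M => Real.cos (2 * π * p * k.val / M)) := by
    induction r with
    | zero => simp
    | succ r ih =>
      have h1 : (Qmat M s).mulVec (fun k => Real.cos (2 * π * p * k.val / M)) =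
          lam M s p • (fun k : ZMod M => Real.cos (2 * π * p * k.val / M)) := by
        funext i
        exact Q_eigen M hM s hs p i
      rw [pow_succ, ← Matrix.mulVec_mulVec, h1, Matrix.mulVec_smul, ih, smul_smul, pow_succ,
        mul_comm]
  exact congrFun key j

lemma Q_pow_diag (M : ℕ) [NeZero M] (hM : 2 ≤ M) (s : ℝ) (hs : 0 ≤ s) (r : ℕ) :
    (Qmat M s ^ r) 0 0 = (1 / M : ℝ) * ∑ p ∈ Finset.range M, lam M s p ^ r := by
  have hM0 : (M : ℝ) ≠ 0 := Nat.cast_ne_zero.2 (NeZero.ne M)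
  have h1 : ∑ p ∈ Finset.range M, lam M s p ^ r =
      ∑ p ∈ Finset.range M, ∑ k : ZMod M, (Qmat M s ^ r) 0 k * Real.cos (2 * π * p * k.val / M) := by
    refine Finset.sum_congr rfl fun p _ => ?_
    rw [Q_pow_eigen M hM s hs p r 0]; simp
  have h2 : ∀ k : ZMod M, ∑ p ∈ Finset.range M, Real.cos (2 * π * p * k.val / M) =
      if k = 0 then (M : ℝ) else 0 := by
    intro k
    have := orth M (by omega) 0 (k.val : ℤ)
    simp only [zero_add, Real.cos_zero, mul_one] at this
    have hd : ((M : ℤ) ∣ (k.val : ℤ)) ↔ k = 0 := by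
      rw [Int.natCast_dvd_natCast, ← ZMod.natCast_eq_zero_iff, ZMod.natCast_zmod_val]
    simp only [hd] at this
    rw [← this]
    refine Finset.sum_congr rfl fun p _ => ?_
    congr 1
    push_cast; ring
  rw [h1, Finset.sum_comm]
  simp_rw [← Finset.mul_sum, h2]
  simp
  field_simp

lemma gauss_sum (α : ℝ) (hα : 0 < α) (N : ℕ) :
    ∑ i ∈ Finset.range N, Real.exp (-α * ((i + 1 : ℕ) : ℝ) ^ 2) ≤ √(π / α) / 2 := by
  have hanti : AntitoneOn (fun x : ℝ => Real.exp (-α * x ^ 2)) (Set.Icc 0 (0 + (N : ℝ))) := by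
    intro x hx y hy hxy
    have : x ^ 2 ≤ y ^ 2 := pow_le_pow_left₀ hx.1 hxy 2
    apply Real.exp_le_exp.2
    nlinarith
  have h := hanti.sum_le_integral
  simp only [zero_add] at h
  refine h.trans ?_
  rw [← integral_gaussian_Ioi, intervalIntegral.integral_of_le (by positivity)]
  refine setIntegral_mono_set ?_ ?_ ?_
  · exact (integrable_exp_neg_mul_sq hα).integrableOn
  · exact Filter.Eventually.of_forall fun x => (Real.exp_pos _).le
  · exact Filter.Eventually.of_forall fun x hx => hx.1

lemma Q_diag_le (M : ℕ) [NeZero M] (hM : 2 ≤ M) (s : ℝ) (hs : 0 < s) (m : ℕ) (hm : 1 ≤ m) :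
    (Qmat M s ^ (2 * m)) 0 0 ≤ (1 / M : ℝ) * (1 + 1 / √(m * s)) := by
  have hms : 0 < (m : ℝ) * s := by
    have : (1 : ℝ) ≤ m := by exact_mod_cast hm
    positivity
  rw [Q_pow_diag M hM s hs.le]
  refine mul_le_mul_of_nonneg_left ?_ (by positivity)
  set α := 4 * π ^ 2 * (m * s) with hα
  have hαpos : 0 < α := by positivity
  have hg : ∀ n : ℕ, gau s n ^ (2 * m) = Real.exp (-α * (n : ℝ) ^ 2) := by
    intro n
    rw [gau, ← Real.exp_nat_mul]
    congr 1; rw [hα]; push_cast; ring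
  obtain ⟨N, rfl⟩ : ∃ N, M = N + 1 := ⟨M - 1, by omega⟩
  rw [Finset.sum_range_succ']
  have h0 : lam (N + 1) s 0 ^ (2 * m) ≤ 1 := by
    refine pow_le_one₀ (lam_nonneg _ _ _) ((lam_le _ hM s hs.le 0 (by omega)).trans ?_)
    unfold gau
    apply max_le <;> rw [Real.exp_le_one_iff] <;> simp <;> positivity
  have hp : ∀ p ∈ Finset.range N, lam (N + 1) s (p + 1) ^ (2 * m) ≤
      Real.exp (-α * ((p + 1 : ℕ) : ℝ) ^ 2) + Real.exp (-α * ((N - 1 - p + 1 : ℕ) : ℝ) ^ 2) := by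
    intro p hp
    have hp' := Finset.mem_range.1 hp
    have e := lam_le (N + 1) hM s hs.le (p + 1) (by omega)
    have e2 := pow_le_pow_left₀ (lam_nonneg _ _ _) e (2 * m)
    refine e2.trans ?_
    have e3 : N + 1 - (p + 1) = N - 1 - p + 1 := by omega
    rw [← hg, ← hg, e3]
    have q1 := pow_pos (gau_pos s (p + 1)) (2 * m)
    have q2 := pow_pos (gau_pos s (N - 1 - p + 1)) (2 * m)
    rcases max_choice (gau s (p + 1)) (gau s (N - 1 - p + 1)) with h | h <;> rw [h] <;> linarith
  have hs1 := Finset.sum_le_sum hp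
  rw [Finset.sum_add_distrib,
    Finset.sum_range_reflect (fun i => Real.exp (-α * ((i + 1 : ℕ) : ℝ) ^ 2)) N] at hs1
  have hG := gauss_sum α hαpos N
  have hsq : √(π / α) ≤ 1 / √(m * s) := by
    rw [← Real.sqrt_one, ← Real.sqrt_div zero_le_one]
    apply Real.sqrt_le_sqrt
    rw [hα, div_le_div_iff₀ (by positivity) hms]
    have := Real.pi_gt_three
    have : π ≤ 4 * π ^ 2 := by nlinarith
    nlinarith
  linarith

lemma sum_inv_sqrt (N : ℕ) : ∑ i ∈ Finset.range N, 1 / √((i + 1 : ℕ) : ℝ) ≤ 2 * √(N : ℝ) := by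
  induction N with
  | zero => simp
  | succ N ih =>
    rw [Finset.sum_range_succ]
    have ha : 0 ≤ √(N : ℝ) := Real.sqrt_nonneg _
    have hb : 0 < √((N + 1 : ℕ) : ℝ) := Real.sqrt_pos.2 (by positivity)
    have ha2 : √(N : ℝ) ^ 2 = N := Real.sq_sqrt (by positivity)
    have hb2 : √((N + 1 : ℕ) : ℝ) ^ 2 = N + 1 := by rw [Real.sq_sqrt (by positivity)]; push_cast; ring
    have : 1 / √((N + 1 : ℕ) : ℝ) ≤ 2 * √((N + 1 : ℕ) : ℝ) - 2 * √(N : ℝ) := by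
      rw [div_le_iff₀ hb]
      nlinarith [sq_nonneg (√((N + 1 : ℕ) : ℝ) - √(N : ℝ))]
    linarith

/-- Sum bound for the diagonal entries of powers of `Q` (formula (4.11)): for every
`T > 0` there is `C > 0` such that for `δt = T/M_T`, `δx = 1/M` and every `1 ≤ n ≤ M_T`,
`∑_{k<n} (Q^{2(n-1-k)})₀₀ ≤ C (1 + δx/δt + (δx²/δt²)(1 + |log δt|))`. -/
theorem sum_diag_Q_pow_bound (T : ℝ) (hT : 0 < T) : ∃ C : ℝ, 0 < C ∧
    ∀ (MT : ℕ), 2 ≤ MT → ∀ (M : ℕ) [NeZero M], 2 ≤ M →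
    ∀ (n : ℕ), 1 ≤ n → n ≤ MT →
      ∑ k ∈ Finset.range n, (Qmat M (T / MT) ^ (2 * (n - 1 - k))) 0 0
        ≤ C * (1 + (1 / M : ℝ) / (T / MT)
            + ((1 / M : ℝ) ^ 2 / (T / MT) ^ 2) * (1 + |Real.log (T / MT)|)) := by
  refine ⟨1 + T + 2 * √T, by positivity, ?_⟩
  intro MT hMT M _ hM n hn hnM
  have hMTpos : (0 : ℝ) < MT := by
    have : 0 < MT := by omega
    exact_mod_cast this
  have hMpos : (0 : ℝ) < M := by
    have : 0 < M := by omega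
    exact_mod_cast this
  set s := T / (MT : ℝ) with hs
  have hspos : 0 < s := by positivity
  have hsT : s * MT = T := by rw [hs]; field_simp
  obtain ⟨N, rfl⟩ : ∃ N, n = N + 1 := ⟨n - 1, by omega⟩
  have hNle : (N : ℝ) ≤ MT := by exact_mod_cast (by omega : N ≤ MT)
  rw [Finset.sum_range_reflect (fun i => (Qmat M s ^ (2 * i)) 0 0) (N + 1),
    Finset.sum_range_succ']
  have h1 : ∑ i ∈ Finset.range N, (Qmat M s ^ (2 * (i + 1))) 0 0 ≤
      ∑ i ∈ Finset.range N, (1 / M : ℝ) * (1 + 1 / √s * (1 / √((i + 1 : ℕ) : ℝ))) := by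
    refine Finset.sum_le_sum fun i _ => ?_
    refine (Q_diag_le M hM s hspos (i + 1) (by omega)).trans_eq ?_
    rw [Real.sqrt_mul (by positivity)]
    ring
  rw [← Finset.mul_sum, Finset.sum_add_distrib, ← Finset.mul_sum] at h1
  simp only [Finset.sum_const, Finset.card_range, nsmul_eq_mul, mul_one] at h1
  have h2 : (N : ℝ) + 1 / √s * ∑ i ∈ Finset.range N, 1 / √((i + 1 : ℕ) : ℝ) ≤
      (T + 2 * √T) / s := by
    have a1 : (N : ℝ) ≤ T / s := by rw [le_div_iff₀ hspos]; nlinarith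
    have a2 : √(N : ℝ) ≤ √T / √s := by
      rw [← Real.sqrt_div hT.le]; exact Real.sqrt_le_sqrt a1
    have a3 : 1 / √s * ∑ i ∈ Finset.range N, 1 / √((i + 1 : ℕ) : ℝ) ≤ 1 / √s * (2 * (√T / √s)) := by
      refine mul_le_mul_of_nonneg_left ((sum_inv_sqrt N).trans ?_) (by positivity)
      linarith
    have a4 : 1 / √s * (2 * (√T / √s)) = 2 * √T / s := by
      have : √s * √s = s := Real.mul_self_sqrt hspos.le
      have h0 : √s ≠ 0 := (Real.sqrt_pos.2 hspos).ne'
      have e : 1 / √s * (2 * (√T / √s)) = 2 * √T / (√s * √s) := by field_simp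
      rw [e, this]
    rw [add_div]
    linarith
  have h3 := h1.trans (mul_le_mul_of_nonneg_left h2 (by positivity : (0 : ℝ) ≤ 1 / M))
  have h4 : (1 / M : ℝ) * ((T + 2 * √T) / s) = (T + 2 * √T) * ((1 / M : ℝ) / s) := by ring
  rw [h4] at h3
  have h5 : 0 ≤ (1 / M : ℝ) / s := by positivity
  have h6 : 0 ≤ ((1 / M : ℝ) ^ 2 / s ^ 2) * (1 + |Real.log s|) := by positivity
  have h7 : 0 ≤ √T := Real.sqrt_nonneg T
  have h8 : 0 ≤ (1 + T + 2 * √T) * (((1 / M : ℝ) ^ 2 / s ^ 2) * (1 + |Real.log s|)) := by positivity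
  simp only [mul_zero, pow_zero, Matrix.one_apply_eq]
  nlinarith
end
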